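/- Let 0 < γ < 1, T > 0, and let h : [0,T] → [0,∞) be measurable. Then ∫₀^T ( ∫₀^t (t−s)^{(γ−1)/2} h(s) ds )² dt ≤ (1/γ) · T^γ · ( ∫₀^T h(s) ds )². (This is the time-integral estimate underlying the bound ∫₀^T ‖∇F(y)(t)‖²_{Ḣ^{1/2+γ}} dt ≲ T^γ (∫₀^T ‖y(t)‖²_{Ḣ^{3/2+γ}} dt)² for the Duhamel term F(y)(t) = −∫₀^t e^{(t−s)Δ} Γ⁻¹ Q(Γy, Γy) ds in the fixed point argument.) -/

import Mathlib

open MeasureTheory Real ENNReal Set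

/-- Cauchy–Schwarz for the weighted measure `h μ`, in `ℝ≥0∞`-valued form. -/
theorem sq_lintegral_mul_le {α : Type*} [MeasurableSpace α] (μ : Measure α)
    {k h : α → ℝ≥0∞} (hk : AEMeasurable k μ) (hh : AEMeasurable h μ) :
    (∫⁻ a, k a * h a ∂μ) ^ 2 ≤ (∫⁻ a, h a ∂μ) * ∫⁻ a, k a ^ 2 * h a ∂μ := by
  have hsq (x : ℝ≥0∞) : (x ^ (1 / 2 : ℝ)) ^ 2 = x := by
    rw [← ENNReal.rpow_natCast, ← ENNReal.rpow_mul]; norm_num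
  have holder := ENNReal.lintegral_mul_le_Lp_mul_Lq μ Real.HolderConjugate.two_two
    (f := fun a => h a ^ (1 / 2 : ℝ)) (g := fun a => k a * h a ^ (1 / 2 : ℝ))
    (hh.pow_const _) (hk.mul (hh.pow_const _))
  have hprod : ∀ a, ((fun a => h a ^ (1 / 2 : ℝ)) * fun a => k a * h a ^ (1 / 2 : ℝ)) a
      = k a * h a := fun a => by
    rw [Pi.mul_apply, mul_left_comm, ← sq, hsq]
  simp only [hprod, ENNReal.rpow_two, mul_pow, hsq] at holder
  calc _ ≤ _ := pow_le_pow_left' holder 2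
    _ = _ := by rw [mul_pow, hsq, hsq]

theorem setLIntegral_Ioc_rpow_sub_one {γ T : ℝ} (hγ : 0 < γ) (hT : 0 ≤ T) :
    ∫⁻ u in Ioc (0 : ℝ) T, ENNReal.ofReal (u ^ (γ - 1)) = ENNReal.ofReal (1 / γ * T ^ γ) := by
  have hint : IntervalIntegrable (fun u : ℝ => u ^ (γ - 1)) volume 0 T :=
    intervalIntegral.intervalIntegrable_rpow' (by linarith)
  rw [← ofReal_integral_eq_lintegral_ofReal
      ((intervalIntegrable_iff_integrableOn_Ioc_of_le hT).1 hint),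
    ← intervalIntegral.integral_of_le hT, integral_rpow (Or.inl (by linarith))]
  · rw [sub_add_cancel, Real.zero_rpow hγ.ne', sub_zero, one_div, div_eq_inv_mul]
  · exact (ae_restrict_mem measurableSet_Ioc).mono fun u hu => Real.rpow_nonneg hu.1.le _

/-- **Time-integral estimate for the Duhamel term**: for `0 < γ < 1`, `T > 0` and a
nonnegative measurable `h : [0,T] → [0,∞)`,
`∫₀^T (∫₀^t (t−s)^{(γ−1)/2} h(s) ds)² dt ≤ (1/γ) T^γ (∫₀^T h(s) ds)²`. -/
theorem duhamel_time_integral_estimate (γ T : ℝ) (hγ0 : 0 < γ) (hγ1 : γ < 1)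
    (hT : 0 < T) (h : ℝ → ℝ) (hmeas : Measurable h) (hpos : ∀ t, 0 ≤ h t) :
    (∫⁻ t in Ioc (0 : ℝ) T,
        (∫⁻ s in Ioc (0 : ℝ) t, ENNReal.ofReal ((t - s) ^ ((γ - 1) / 2) * h s)) ^ 2)
      ≤ ENNReal.ofReal ((1 / γ) * T ^ γ) *
          (∫⁻ s in Ioc (0 : ℝ) T, ENNReal.ofReal (h s)) ^ 2 := by
  set H : ℝ → ℝ≥0∞ := fun s => ENNReal.ofReal (h s)
  have hHm : Measurable H := hmeas.ennreal_ofReal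
  set k : ℝ → ℝ≥0∞ := (Ioc (0 : ℝ) T).indicator fun u => ENNReal.ofReal (u ^ (γ - 1)) with hk
  have hkm : Measurable k := Measurable.indicator (by fun_prop) measurableSet_Ioc
  have kernel_le {s t : ℝ} (hs : s ∈ Ioc 0 t) (ht : t ≤ T) :
      ENNReal.ofReal ((t - s) ^ ((γ - 1) / 2)) ^ 2 ≤ k (t - s) := by
    rcases hs.2.eq_or_lt with rfl | hst
    · rw [sub_self, Real.zero_rpow (by linarith)]
      simp
    · have hu : 0 < t - s := sub_pos.2 hst
      rw [hk, indicator_of_mem (show t - s ∈ Ioc 0 T from ⟨hu, by linarith [hs.1]⟩),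
        ← ENNReal.ofReal_pow (Real.rpow_nonneg hu.le _), ← Real.rpow_natCast,
        ← Real.rpow_mul hu.le]
      norm_num
  have pointwise {t : ℝ} (ht : t ∈ Ioc 0 T) :
      (∫⁻ s in Ioc (0 : ℝ) t, ENNReal.ofReal ((t - s) ^ ((γ - 1) / 2) * h s)) ^ 2
        ≤ (∫⁻ s in Ioc 0 T, H s) * ∫⁻ s in Ioc 0 T, k (t - s) * H s := by
    simp_rw [fun s => ENNReal.ofReal_mul' (p := (t - s) ^ ((γ - 1) / 2)) (hpos s)]
    refine (sq_lintegral_mul_le _ (by fun_prop) hHm.aemeasurable).trans ?_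
    gcongr ?_ * ?_
    · exact lintegral_mono_set (Ioc_subset_Ioc_right ht.2)
    · refine (setLIntegral_mono' measurableSet_Ioc fun s hs => ?_).trans
        (lintegral_mono_set (Ioc_subset_Ioc_right ht.2))
      gcongr
      exact kernel_le hs ht.2
  have swapped : ∫⁻ t in Ioc 0 T, ∫⁻ s in Ioc 0 T, k (t - s) * H s
      ≤ ENNReal.ofReal (1 / γ * T ^ γ) * ∫⁻ s in Ioc 0 T, H s := by
    rw [lintegral_lintegral_swap (by fun_prop), ← lintegral_const_mul _ hHm]
    refine lintegral_mono fun s => ?_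
    rw [lintegral_mul_const _ (by fun_prop)]
    gcongr
    calc ∫⁻ t in Ioc 0 T, k (t - s) ≤ ∫⁻ t, k (t - s) := setLIntegral_le_lintegral _ _
      _ = ∫⁻ u, k u := lintegral_sub_right_eq_self k s
      _ = _ := by
        rw [hk, lintegral_indicator measurableSet_Ioc, setLIntegral_Ioc_rpow_sub_one hγ0 hT.le]
  calc _ ≤ ∫⁻ t in Ioc 0 T, (∫⁻ s in Ioc 0 T, H s) * ∫⁻ s in Ioc 0 T, k (t - s) * H s :=
        setLIntegral_mono' measurableSet_Ioc fun t ht => pointwise ht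
    _ = (∫⁻ s in Ioc 0 T, H s) * ∫⁻ t in Ioc 0 T, ∫⁻ s in Ioc 0 T, k (t - s) * H s :=
        lintegral_const_mul _ (Measurable.lintegral_prod_right' (f := fun p : ℝ × ℝ =>
          k (p.1 - p.2) * H p.2) (by fun_prop))
    _ ≤ (∫⁻ s in Ioc 0 T, H s) * (ENNReal.ofReal (1 / γ * T ^ γ) * ∫⁻ s in Ioc 0 T, H s) := by
        gcongr
    _ = _ := by ring
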